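/- Let A_S be an Artin group of large type and let P₁ and P₂ be parabolic subgroups of A_S with P₁ ⊆ P₂. Then the inclusion P₁ ⊆ P₂ is conjugate to an inclusion of standard parabolic subgroups: there exist g ∈ A_S and subsets S'' ⊆ S' ⊆ S such that P₁ = g A_{S''} g⁻¹ and P₂ = g A_{S'} g⁻¹. -/

import Mathlib

/-- The alternating word `sts⋯` of length `k` in the free group on `S`. -/
def braidWord {S : Type*} (k : ℕ) (s t : S) : FreeGroup S :=
  ((List.range k).map fun i => FreeGroup.of (if i % 2 = 0 then s else t)).prod

/-- The braid relations of the Artin group with Coxeter-type matrix `M`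
(`M s t = ⊤` means no relation). -/
def artinRels {S : Type*} (M : S → S → ℕ∞) : Set (FreeGroup S) :=
  { r | ∃ s t : S, s ≠ t ∧ ∃ k : ℕ, M s t = (k : ℕ∞) ∧
      r = braidWord k s t * (braidWord k t s)⁻¹ }

/-- The Artin group associated to the matrix `M`. -/
abbrev ArtinGroup {S : Type*} (M : S → S → ℕ∞) : Type _ := PresentedGroup (artinRels M)

/-- The standard parabolic subgroup `A_X` generated by the images of elements of `X ⊆ S`. -/
def StandardParabolic {S : Type*} (M : S → S → ℕ∞) (X : Set S) : Subgroup (ArtinGroup M) :=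
  Subgroup.closure ((fun s => (PresentedGroup.of s : ArtinGroup M)) '' X)

/-- The conjugate `g H g⁻¹` of a subgroup. -/
def conjSubgroup {G : Type*} [Group G] (g : G) (H : Subgroup G) : Subgroup G :=
  H.map (MulAut.conj g).toMonoidHom

/-- A parabolic subgroup: a conjugate of a standard parabolic subgroup. -/
def IsParabolic {S : Type*} (M : S → S → ℕ∞) (P : Subgroup (ArtinGroup M)) : Prop :=
  ∃ (g : ArtinGroup M) (X : Set S), P = conjSubgroup g (StandardParabolic M X)

open Real in
/-- The numbers `sin (kπ/m) / sin (π/m)` (and their limit `k` when `m = 0`), which are the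
coordinates of the roots of a dihedral group of order `2m` in the basis of simple roots. -/
noncomputable def dihedralCoeff (m k : ℕ) : ℝ :=
  if m = 0 then k else sin (k * (π / m)) / sin (π / m)

section DihedralCoeff

open Real

variable {m : ℕ}

lemma sin_pi_div_pos (hm : m ≠ 0) (hm1 : m ≠ 1) : 0 < sin (π / m) := by
  have h2 : (2 : ℝ) ≤ m := by exact_mod_cast (by omega : 2 ≤ m)
  apply sin_pos_of_pos_of_lt_pi
  · positivity
  · rw [div_lt_iff₀ (by linarith)]
    nlinarith [pi_pos]

@[simp] lemma dihedralCoeff_zero : dihedralCoeff m 0 = 0 := by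
  simp [dihedralCoeff]

lemma dihedralCoeff_one (hm1 : m ≠ 1) : dihedralCoeff m 1 = 1 := by
  unfold dihedralCoeff
  split_ifs with h
  · simp
  · simp [(sin_pi_div_pos h hm1).ne']

lemma dihedralCoeff_add_two (k : ℕ) :
    dihedralCoeff m (k + 2) = 2 * cos (π / m) * dihedralCoeff m (k + 1) - dihedralCoeff m k := by
  unfold dihedralCoeff
  split_ifs with h
  · subst h
    simp
    ring
  · have h1 : ((k + 2 : ℕ) : ℝ) * (π / m) = ((k + 1 : ℕ) : ℝ) * (π / m) + π / m := by
      push_cast; ring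
    have h2 : (k : ℝ) * (π / m) = ((k + 1 : ℕ) : ℝ) * (π / m) - π / m := by
      push_cast; ring
    rw [h1, h2, sin_add, sin_sub]
    ring

lemma dihedralCoeff_pos (hm1 : m ≠ 1) {k : ℕ} (hk : 0 < k) (hkm : m = 0 ∨ k < m) :
    0 < dihedralCoeff m k := by
  unfold dihedralCoeff
  split_ifs with h
  · exact_mod_cast hk
  · have hkm : k < m := hkm.resolve_left h
    have hm : (0 : ℝ) < m := by exact_mod_cast Nat.pos_of_ne_zero h
    have hk' : (0 : ℝ) < k := by exact_mod_cast hk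
    have hkm' : (k : ℝ) < m := by exact_mod_cast hkm
    refine div_pos (sin_pos_of_pos_of_lt_pi (by positivity) ?_) (sin_pi_div_pos h hm1)
    rw [← mul_div_assoc, div_lt_iff₀ hm, mul_comm]
    exact mul_lt_mul_of_pos_left hkm' pi_pos

lemma dihedralCoeff_self (hm : m ≠ 0) : dihedralCoeff m m = 0 := by
  have hm' : (m : ℝ) ≠ 0 := by exact_mod_cast hm
  simp [dihedralCoeff, hm, mul_div_cancel₀ π hm']

lemma dihedralCoeff_nonneg (hm1 : m ≠ 1) {k : ℕ} (hkm : m = 0 ∨ k ≤ m) :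
    0 ≤ dihedralCoeff m k := by
  rcases Nat.eq_zero_or_pos k with rfl | hk
  · simp
  by_cases h : m = 0 ∨ k < m
  · exact (dihedralCoeff_pos hm1 hk h).le
  · obtain rfl : k = m := by omega
    rw [dihedralCoeff_self hk.ne']

lemma dihedralCoeff_pred (hm : m ≠ 0) (hm1 : m ≠ 1) : dihedralCoeff m (m - 1) = 1 := by
  have hm' : (m : ℝ) ≠ 0 := by exact_mod_cast hm
  rw [dihedralCoeff, if_neg hm, Nat.cast_sub (by omega), Nat.cast_one, sub_mul, one_mul,
    mul_div_cancel₀ π hm', sin_pi_sub, div_self (sin_pi_div_pos hm hm1).ne']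

lemma dihedralCoeff_two_mul (hm : m ≠ 0) : dihedralCoeff m (2 * m) = 0 := by
  have hm' : (m : ℝ) ≠ 0 := by exact_mod_cast hm
  simp [dihedralCoeff, hm, mul_assoc, mul_div_cancel₀ π hm']

lemma dihedralCoeff_two_mul_add_one (hm : m ≠ 0) (hm1 : m ≠ 1) :
    dihedralCoeff m (2 * m + 1) = 1 := by
  have hm' : (m : ℝ) ≠ 0 := by exact_mod_cast hm
  have h : ((2 * m + 1 : ℕ) : ℝ) * (π / m) = π / m + 2 * π := by
    push_cast
    field_simp
    ring
  rw [dihedralCoeff, if_neg hm, h, sin_add_two_pi, div_self (sin_pi_div_pos hm hm1).ne']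

end DihedralCoeff

namespace CoxeterMatrix

open Real Module

variable {B : Type*} (M : CoxeterMatrix B)

/-- The simple root of index `i` in the geometric representation. -/
noncomputable def simpleRoot (i : B) : B →₀ ℝ := Finsupp.single i 1

/-- The linear form `v ↦ 2 B(αᵢ, v)`, where `B` is the Tits form. -/
noncomputable def simpleCoroot (i : B) : Dual ℝ (B →₀ ℝ) :=
  Finsupp.linearCombination ℝ fun j => -2 * cos (π / M i j)

/-- Twice the Tits bilinear form. -/
noncomputable def titsForm : (B →₀ ℝ) →ₗ[ℝ] Dual ℝ (B →₀ ℝ) :=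
  Finsupp.linearCombination ℝ M.simpleCoroot

lemma simpleRoot_injective : Function.Injective (simpleRoot : B → B →₀ ℝ) :=
  Finsupp.single_left_injective one_ne_zero

lemma simpleRoot_nonneg (i : B) : 0 ≤ simpleRoot i := by
  simp [simpleRoot]

@[simp] lemma simpleCoroot_simpleRoot (i j : B) :
    M.simpleCoroot i (simpleRoot j) = -2 * cos (π / M i j) := by
  simp [simpleCoroot, simpleRoot]

@[simp] lemma titsForm_simpleRoot (i : B) : M.titsForm (simpleRoot i) = M.simpleCoroot i := by
  simp [titsForm, simpleRoot]

lemma titsForm_comm (u v : B →₀ ℝ) : M.titsForm u v = M.titsForm v u := by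
  induction u using Finsupp.induction_linear with
  | zero => simp
  | add u u' h h' => simp [h, h']
  | single i a =>
    induction v using Finsupp.induction_linear with
    | zero => simp
    | add v v' h h' => simp [h, h']
    | single j b =>
      simp [titsForm, simpleCoroot, M.symmetric i j]
      ring

lemma simpleCoroot_self (i : B) : M.simpleCoroot i (simpleRoot i) = 2 := by simp

/-- The simple reflection of index `i` in the geometric representation. -/
noncomputable def simpleReflection (i : B) : (B →₀ ℝ) ≃ₗ[ℝ] (B →₀ ℝ) :=
  Module.reflection (M.simpleCoroot_self i)

lemma simpleReflection_apply (i : B) (v : B →₀ ℝ) :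
    M.simpleReflection i v = v - M.simpleCoroot i v • simpleRoot i :=
  Module.reflection_apply v _

@[simp] lemma simpleReflection_simpleRoot_self (i : B) :
    M.simpleReflection i (simpleRoot i) = -simpleRoot i :=
  Module.reflection_apply_self _

lemma simpleReflection_simpleRoot (i j : B) :
    M.simpleReflection i (simpleRoot j) = simpleRoot j + (2 * cos (π / M i j)) • simpleRoot i := by
  rw [simpleReflection_apply, simpleCoroot_simpleRoot, neg_mul, neg_smul, sub_neg_eq_add]

lemma simpleReflection_mul_self (i : B) : M.simpleReflection i * M.simpleReflection i = 1 := by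
  ext1 v
  exact Module.involutive_reflection (M.simpleCoroot_self i) v

lemma titsForm_simpleReflection (i : B) (u v : B →₀ ℝ) :
    M.titsForm (M.simpleReflection i u) (M.simpleReflection i v) = M.titsForm u v := by
  have h : M.titsForm u (simpleRoot i) = M.simpleCoroot i u := by
    rw [titsForm_comm, titsForm_simpleRoot]
  simp only [simpleReflection_apply, map_sub, map_smul, titsForm_simpleRoot, LinearMap.sub_apply,
    LinearMap.smul_apply, h, simpleCoroot_self, smul_eq_mul]
  ring

/-- A simple reflection exchanges consecutive roots of the dihedral subsystem. -/
lemma simpleReflection_dihedral (i j : B) (k : ℕ) :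
    M.simpleReflection i (dihedralCoeff (M i j) (k + 1) • simpleRoot j +
        dihedralCoeff (M i j) k • simpleRoot i) =
      dihedralCoeff (M i j) (k + 2) • simpleRoot i +
        dihedralCoeff (M i j) (k + 1) • simpleRoot j := by
  rw [map_add, map_smul, map_smul, simpleReflection_simpleRoot, simpleReflection_simpleRoot_self,
    dihedralCoeff_add_two]
  module

lemma simpleReflection_mul_pow_simpleRoot {i j : B} (hij : i ≠ j) (k : ℕ) :
    ((M.simpleReflection i * M.simpleReflection j) ^ k) (simpleRoot i) =
      dihedralCoeff (M i j) (2 * k + 1) • simpleRoot i +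
        dihedralCoeff (M i j) (2 * k) • simpleRoot j := by
  induction k with
  | zero => simp [dihedralCoeff_one (M.off_diagonal i j hij)]
  | succ k ih =>
    rw [pow_succ', LinearEquiv.mul_apply, ih, LinearEquiv.mul_apply, M.symmetric i j,
      simpleReflection_dihedral, M.symmetric j i, simpleReflection_dihedral]
    rfl

lemma titsForm_pow {i j : B} (k : ℕ) (u v : B →₀ ℝ) :
    M.titsForm (((M.simpleReflection i * M.simpleReflection j) ^ k) u)
      (((M.simpleReflection i * M.simpleReflection j) ^ k) v) = M.titsForm u v := by
  induction k with
  | zero => simp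
  | succ k ih =>
    simp only [pow_succ', LinearEquiv.mul_apply, titsForm_simpleReflection] at ih ⊢
    exact ih

lemma exists_simpleReflection_mul_pow_apply {i j : B} (k : ℕ) (v : B →₀ ℝ) :
    ∃ a b : ℝ, ((M.simpleReflection i * M.simpleReflection j) ^ k) v =
      v + (a • simpleRoot i + b • simpleRoot j) := by
  induction k with
  | zero => exact ⟨0, 0, by simp⟩
  | succ k ih =>
    obtain ⟨a, b, h⟩ := ih
    rw [pow_succ', LinearEquiv.mul_apply, h, LinearEquiv.mul_apply, simpleReflection_apply,
      simpleReflection_apply]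
    generalize M.simpleCoroot j _ = c
    generalize M.simpleCoroot i _ = d
    exact ⟨a - d, b - c, by module⟩

lemma simpleReflection_mul_pow (i j : B) :
    (M.simpleReflection i * M.simpleReflection j) ^ M i j = 1 := by
  rcases eq_or_ne i j with rfl | hij
  · simp [simpleReflection_mul_self]
  rcases eq_or_ne (M i j) 0 with h0 | h0
  · rw [h0, pow_zero]
  set g := (M.simpleReflection i * M.simpleReflection j) ^ M i j with hg
  have h1 := M.off_diagonal i j hij
  have hi : g (simpleRoot i) = simpleRoot i := by
    simp [hg, M.simpleReflection_mul_pow_simpleRoot hij, dihedralCoeff_two_mul h0,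
      dihedralCoeff_two_mul_add_one h0 h1]
  have hj : g (simpleRoot j) = simpleRoot j := by
    have hinv : g⁻¹ = (M.simpleReflection j * M.simpleReflection i) ^ M j i := by
      rw [hg, ← inv_pow, mul_inv_rev, M.symmetric i j,
        inv_eq_of_mul_eq_one_right (M.simpleReflection_mul_self i),
        inv_eq_of_mul_eq_one_right (M.simpleReflection_mul_self j)]
    have : g⁻¹ (simpleRoot j) = simpleRoot j := by
      rw [M.symmetric] at h0 h1
      simp [hinv, M.simpleReflection_mul_pow_simpleRoot hij.symm, dihedralCoeff_two_mul h0,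
        dihedralCoeff_two_mul_add_one h0 h1]
    rw [← this, ← LinearEquiv.mul_apply, mul_inv_cancel, this]
    rfl
  ext1 v
  obtain ⟨a, b, h⟩ := M.exists_simpleReflection_mul_pow_apply (i := i) (j := j) (M i j) v
  rw [← hg] at h
  have ei := M.titsForm_pow (i := i) (j := j) (M i j) (simpleRoot i) v
  have ej := M.titsForm_pow (i := i) (j := j) (M i j) (simpleRoot j) v
  rw [← hg, h] at ei ej
  rw [hi] at ei
  rw [hj] at ej
  simp only [titsForm_simpleRoot, map_add, map_smul, simpleCoroot_self, simpleCoroot_simpleRoot,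
    smul_eq_mul, M.symmetric j i] at ei ej
  have hs := sin_pi_div_pos h0 h1
  have hsc := sin_sq_add_cos_sq (π / M i j)
  have hc : 1 - cos (π / M i j) ^ 2 ≠ 0 := by nlinarith
  have ea : a = 0 := by
    have : a * (1 - cos (π / M i j) ^ 2) = 0 := by
      linear_combination ei / 2 + cos (π / M i j) * ej / 2
    simpa [hc] using this
  have eb : b = 0 := by
    have : b * (1 - cos (π / M i j) ^ 2) = 0 := by
      linear_combination ej / 2 + cos (π / M i j) * ei / 2
    simpa [hc] using this
  rw [h, ea, eb]
  simp

end CoxeterMatrix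

section DescProd

/-- The letter number `j` of the alternating word `s, t, s, t, …`. -/
def alternate {S : Type*} (s t : S) (j : ℕ) : S := if j % 2 = 0 then s else t

/-- The product `f (i + k - 1) * ⋯ * f (i + 1) * f i`. -/
def descProd {G : Type*} [Monoid G] (f : ℕ → G) : ℕ → ℕ → G
  | _, 0 => 1
  | i, k + 1 => descProd f (i + 1) k * f i

variable {S G H : Type*} [Monoid G] [Monoid H]

@[simp] lemma alternate_zero (s t : S) : alternate s t 0 = s := rfl

@[simp] lemma alternate_one (s t : S) : alternate s t 1 = t := rfl

lemma alternate_eq_of_mod {i j : ℕ} (s t : S) (h : i % 2 = j % 2) :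
    alternate s t i = alternate s t j := by
  simp [alternate, h]

lemma alternate_add_two (s t : S) (j : ℕ) : alternate s t (j + 2) = alternate s t j :=
  alternate_eq_of_mod s t (by omega)

lemma alternate_swap (s t : S) (j : ℕ) : alternate t s j = alternate s t (j + 1) := by
  unfold alternate
  split_ifs <;> first | rfl | omega

lemma comp_alternate {T : Type*} (f : S → T) (s t : S) (j : ℕ) :
    f (alternate s t j) = alternate (f s) (f t) j := by
  unfold alternate
  split_ifs <;> rfl

@[simp] lemma descProd_zero (f : ℕ → G) (i : ℕ) : descProd f i 0 = 1 := rfl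

lemma descProd_succ (f : ℕ → G) (i k : ℕ) :
    descProd f i (k + 1) = descProd f (i + 1) k * f i := rfl

lemma descProd_add (f : ℕ → G) (i k l : ℕ) :
    descProd f i (k + l) = descProd f (i + k) l * descProd f i k := by
  induction k generalizing i with
  | zero => simp
  | succ k ih =>
    rw [Nat.add_right_comm k 1 l, descProd_succ, descProd_succ, ih, mul_assoc,
      Nat.add_right_comm i 1 k, Nat.add_assoc]

lemma descProd_succ' (f : ℕ → G) (i k : ℕ) :
    descProd f i (k + 1) = f (i + k) * descProd f i k := by
  rw [descProd_add, descProd_succ, descProd_zero, one_mul]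

lemma map_descProd (φ : G →* H) (f : ℕ → G) (i k : ℕ) :
    φ (descProd f i k) = descProd (fun j => φ (f j)) i k := by
  induction k generalizing i with
  | zero => simp
  | succ k ih => rw [descProd_succ, map_mul, ih, descProd_succ]

lemma descProd_congr_add {f g : ℕ → G} {d : ℕ} (h : ∀ j, f j = g (j + d)) (i k : ℕ) :
    descProd f i k = descProd g (i + d) k := by
  induction k generalizing i with
  | zero => simp
  | succ k ih => rw [descProd_succ, ih, descProd_succ, h, Nat.add_right_comm]

lemma descProd_alternate_eq_of_mod (f : S → G) (s t : S) {i j : ℕ} (h : i % 2 = j % 2) (k : ℕ) :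
    descProd (fun n => f (alternate s t n)) i k = descProd (fun n => f (alternate s t n)) j k := by
  induction k generalizing i j with
  | zero => simp
  | succ k ih =>
    rw [descProd_succ, descProd_succ, ih (by omega : (i + 1) % 2 = (j + 1) % 2),
      alternate_eq_of_mod s t h]

lemma descProd_alternate_swap (f : S → G) (s t : S) (i k : ℕ) :
    descProd (fun n => f (alternate t s n)) i k =
      descProd (fun n => f (alternate s t n)) (i + 1) k :=
  descProd_congr_add (fun j => by rw [alternate_swap]) i k

lemma prod_map_range_alternate (f : S → G) (s t : S) (k : ℕ) :
    ((List.range k).map fun j => f (alternate s t j)).prod =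
      descProd (fun n => f (alternate s t n)) (k + 1) k := by
  induction k with
  | zero => simp
  | succ k ih =>
    rw [List.range_succ, List.map_append, List.prod_append, ih, List.map_singleton,
      List.prod_singleton, ← descProd_succ (fun n => f (alternate s t n))]
    exact descProd_alternate_eq_of_mod f s t (by omega) _

/-- The braid relation, in terms of `descProd`. -/
lemma prod_map_range_alternate_eq_iff (f : S → G) (s t : S) (k : ℕ) :
    ((List.range k).map fun j => f (alternate s t j)).prod =
        ((List.range k).map fun j => f (alternate t s j)).prod ↔
      descProd (fun n => f (alternate s t n)) 0 k =
        descProd (fun n => f (alternate s t n)) 1 k := by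
  rw [prod_map_range_alternate f s t, prod_map_range_alternate f t s,
    descProd_alternate_swap f s t]
  rcases Nat.mod_two_eq_zero_or_one k with h | h
  · rw [descProd_alternate_eq_of_mod f s t (by omega : (k + 1) % 2 = 1 % 2),
      descProd_alternate_eq_of_mod f s t (by omega : (k + 1 + 1) % 2 = 0 % 2), eq_comm]
  · rw [descProd_alternate_eq_of_mod f s t (by omega : (k + 1) % 2 = 0 % 2),
      descProd_alternate_eq_of_mod f s t (by omega : (k + 1 + 1) % 2 = 1 % 2)]

end DescProd

namespace CoxeterSystem

open Real

variable {B W : Type*} [Group W] {M : CoxeterMatrix B} (cs : CoxeterSystem M W)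

/-- The product of simple reflections `⋯ts` over a segment of an alternating word. -/
def altProd (s t : B) (i k : ℕ) : W := descProd (fun j => cs.simple (alternate s t j)) i k

lemma altProd_eq_wordProd (s t : B) (i k : ℕ) :
    cs.altProd s t i k =
      cs.wordProd (alternatingWord (alternate s t (i + 1)) (alternate s t i) k) := by
  induction k generalizing i with
  | zero => simp [altProd, alternatingWord]
  | succ k ih =>
    rw [alternatingWord_succ, wordProd_concat, altProd, descProd_succ, ← altProd, ih,
      alternate_add_two]

lemma altProd_braid (s t : B) : cs.altProd s t 0 (M s t) = cs.altProd s t 1 (M s t) := by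
  rw [altProd_eq_wordProd, altProd_eq_wordProd]
  have h := cs.wordProd_braidWord_eq t s
  rwa [braidWord, braidWord, M.symmetric t s] at h

lemma matrix_alternate (M : CoxeterMatrix B) (s t : B) (j : ℕ) :
    M (alternate s t j) (alternate s t (j + 1)) = M s t := by
  rcases Nat.mod_two_eq_zero_or_one j with h | h
  · simp [alternate, h, Nat.add_mod]
  · simp [alternate, h, Nat.add_mod, M.symmetric]

lemma length_altProd_lt (s t : B) (i : ℕ) {k : ℕ} (h0 : M s t ≠ 0) (hk : M s t < k) :
    cs.length (cs.altProd s t i k) < k := by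
  have hM : M (alternate s t (i + 1)) (alternate s t i) = M s t := by
    rw [M.symmetric, matrix_alternate]
  have h := cs.not_isReduced_alternatingWord (alternate s t (i + 1)) (alternate s t i)
    (by rwa [hM]) (by rwa [hM] : k > _)
  have hle := cs.length_wordProd_le (alternatingWord (alternate s t (i + 1)) (alternate s t i) k)
  rw [IsReduced] at h
  rw [altProd_eq_wordProd]
  rw [length_alternatingWord] at h hle
  omega

/-- The geometric representation of a Coxeter group. -/
noncomputable def geomRep : W →* ((B →₀ ℝ) ≃ₗ[ℝ] (B →₀ ℝ)) :=
  cs.lift ⟨M.simpleReflection, M.simpleReflection_mul_pow⟩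

@[simp] lemma geomRep_simple (i : B) : cs.geomRep (cs.simple i) = M.simpleReflection i :=
  cs.lift_apply_simple _ i

/-- The image of the simple root of index `i` under `w`. -/
noncomputable def root (w : W) (i : B) : B →₀ ℝ := cs.geomRep w (CoxeterMatrix.simpleRoot i)

@[simp] lemma root_one (i : B) : cs.root 1 i = CoxeterMatrix.simpleRoot i := by simp [root]

lemma root_mul (v w : W) (i : B) : cs.root (v * w) i = cs.geomRep v (cs.root w i) := by
  simp [root]

lemma root_mul_simple (w : W) (i : B) : cs.root (w * cs.simple i) i = -cs.root w i := by
  simp [root]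

lemma root_simple_mul (w : W) (i j : B) :
    cs.root (cs.simple j * w) i = M.simpleReflection j (cs.root w i) := by
  simp [root]

lemma titsForm_geomRep (w : W) (u v : B →₀ ℝ) :
    M.titsForm (cs.geomRep w u) (cs.geomRep w v) = M.titsForm u v := by
  induction w using cs.simple_induction_left with
  | one => simp
  | mul_simple_left w i h =>
    rw [map_mul, geomRep_simple, LinearEquiv.mul_apply, LinearEquiv.mul_apply,
      M.titsForm_simpleReflection, h]

lemma titsForm_root (w : W) (i j : B) :
    M.titsForm (cs.root w i) (cs.root w j) = -2 * cos (π / M i j) := by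
  simp [root, titsForm_geomRep]

lemma geomRep_eq_iff (w : W) (u v : B →₀ ℝ) : cs.geomRep w u = v ↔ u = cs.geomRep w⁻¹ v := by
  constructor
  · rintro rfl
    rw [← LinearEquiv.mul_apply, ← map_mul, inv_mul_cancel, map_one]
    rfl
  · rintro rfl
    rw [← LinearEquiv.mul_apply, ← map_mul, mul_inv_cancel, map_one]
    rfl

/-- The roots of a dihedral parabolic subgroup in terms of the two simple roots. -/
lemma root_altProd_inv {s t : B} (hst : s ≠ t) (i k : ℕ) :
    cs.root (cs.altProd s t i k)⁻¹ (alternate s t (i + k)) =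
      dihedralCoeff (M s t) (k + 1) • CoxeterMatrix.simpleRoot (alternate s t i) +
        dihedralCoeff (M s t) k • CoxeterMatrix.simpleRoot (alternate s t (i + 1)) := by
  induction k generalizing i with
  | zero => simp [altProd, dihedralCoeff_one (M.off_diagonal s t hst)]
  | succ k ih =>
    rw [altProd, descProd_succ, ← altProd, mul_inv_rev, inv_simple, root_simple_mul,
      show i + (k + 1) = i + 1 + k by omega, ih, alternate_add_two]
    have := M.simpleReflection_dihedral (alternate s t i) (alternate s t (i + 1)) k
    rwa [matrix_alternate] at this

/-- Every element is the product of an element without right descents in `{s, t}` and of an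
alternating word, with lengths adding up. -/
lemma exists_eq_mul_altProd_inv (s t : B) (w : W) (j : ℕ)
    (hw : ¬cs.IsRightDescent w (alternate s t j)) :
    ∃ v i k, w = v * (cs.altProd s t i k)⁻¹ ∧ cs.length w = cs.length v + k ∧
      ¬cs.IsRightDescent v (alternate s t i) ∧ ¬cs.IsRightDescent v (alternate s t (i + 1)) ∧
      (i + k) % 2 = j % 2 := by
  induction hn : cs.length w generalizing w j with
  | zero =>
    obtain rfl := cs.length_eq_zero_iff.1 hn
    exact ⟨1, j, 0, by simp [altProd], by simp, cs.not_isRightDescent_one _,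
      cs.not_isRightDescent_one _, rfl⟩
  | succ n ih =>
    by_cases h : cs.IsRightDescent w (alternate s t (j + 1))
    · have hl := cs.isRightDescent_iff.1 h
      obtain ⟨v, i, k, h1, h2, h3, h4, h5⟩ := ih (w * cs.simple (alternate s t (j + 1))) (j + 1)
        (cs.isRightDescent_iff_not_isRightDescent_mul.1 h) (by omega)
      refine ⟨v, i, k + 1, ?_, by omega, h3, h4, by omega⟩
      rw [altProd, descProd_succ', ← altProd, mul_inv_rev, inv_simple, alternate_eq_of_mod s t h5,
        ← mul_assoc, ← mul_inv_eq_iff_eq_mul, inv_simple, h1]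
    · exact ⟨w, j, 0, by simp [altProd], by omega, hw, h, rfl⟩

/-- The fundamental theorem on the geometric representation: the sign of a root is governed by
right descents. -/
theorem root_nonneg_of_not_isRightDescent {w : W} {s : B} (hs : ¬cs.IsRightDescent w s) :
    0 ≤ cs.root w s := by
  induction hn : cs.length w using Nat.strong_induction_on generalizing w s with
  | _ n ih =>
    rcases eq_or_ne w 1 with rfl | hw
    · simpa using CoxeterMatrix.simpleRoot_nonneg s
    obtain ⟨t, ht⟩ := cs.exists_rightDescent_of_ne_one hw
    have hst : s ≠ t := by
      rintro rfl
      exact hs ht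
    obtain ⟨v, i, k, h1, h2, h3, h4, h5⟩ := cs.exists_eq_mul_altProd_inv s t w 0 hs
    have hk : k ≠ 0 := by
      rintro rfl
      have hwv : w = v := by simpa [altProd] using h1
      subst hwv
      rcases Nat.mod_two_eq_zero_or_one i with h | h
      · rw [alternate_eq_of_mod s t (by omega : (i + 1) % 2 = 1 % 2)] at h4
        exact h4 ht
      · omega
    have hroot := cs.root_altProd_inv hst i k
    rw [alternate_eq_of_mod s t h5, alternate_zero] at hroot
    have hs' : cs.root w s = dihedralCoeff (M s t) (k + 1) • cs.root v (alternate s t i) +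
        dihedralCoeff (M s t) k • cs.root v (alternate s t (i + 1)) := by
      rw [h1, root_mul, hroot]
      simp [root]
    have hkm : M s t = 0 ∨ k + 1 ≤ M s t := by
      by_contra! hcon
      have hlt := cs.length_altProd_lt s t i hcon.1 hcon.2
      rw [altProd, descProd_succ', ← altProd, alternate_eq_of_mod s t h5] at hlt
      have hle := cs.length_mul_le v (cs.altProd s t i k)⁻¹
      have hmul : w * cs.simple s = v * (cs.simple s * cs.altProd s t i k)⁻¹ := by
        rw [h1]; simp [mul_assoc]
      have hle' := cs.length_mul_le v (cs.simple s * cs.altProd s t i k)⁻¹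
      rw [← hmul, cs.length_inv, cs.not_isRightDescent_iff.1 hs] at hle'
      simp only [alternate_zero] at hlt
      omega
    have h1' := M.off_diagonal s t hst
    rw [hs']
    exact add_nonneg
      (smul_nonneg (dihedralCoeff_nonneg h1' hkm) (ih _ (by omega) h3 rfl))
      (smul_nonneg (dihedralCoeff_nonneg h1' (by omega)) (ih _ (by omega) h4 rfl))

theorem root_nonneg_or_nonpos (w : W) (s : B) : 0 ≤ cs.root w s ∨ cs.root w s ≤ 0 := by
  by_cases h : cs.IsRightDescent w s
  · right
    have := cs.root_nonneg_of_not_isRightDescent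
      (cs.isRightDescent_iff_not_isRightDescent_mul.1 h)
    rw [root_mul_simple] at this
    exact neg_nonneg.1 this
  · exact .inl (cs.root_nonneg_of_not_isRightDescent h)

/-- A simple reflection permutes the positive roots other than its own simple root. -/
lemma root_simple_mul_nonneg {w : W} {i j : B} (hw : 0 ≤ cs.root w i)
    (hne : cs.root w i ≠ CoxeterMatrix.simpleRoot j) : 0 ≤ cs.root (cs.simple j * w) i := by
  refine (cs.root_nonneg_or_nonpos _ _).resolve_right fun hneg => hne ?_
  rw [root_simple_mul, M.simpleReflection_apply] at hneg
  have hsingle : cs.root w i = cs.root w i j • CoxeterMatrix.simpleRoot j := by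
    ext b
    rcases eq_or_ne j b with rfl | hb
    · simp [CoxeterMatrix.simpleRoot]
    · have h1 := hneg b
      have h2 := hw b
      simp [CoxeterMatrix.simpleRoot, hb] at h1 h2 ⊢
      exact le_antisymm h1 h2
  have hform := cs.titsForm_root w i i
  have hj := hw j
  generalize cs.root w i j = r at hsingle hj
  rw [hsingle] at hform ⊢
  simp at hform
  have hr : r = 1 := by
    have : (0 : ℝ) ≤ r := hj
    nlinarith
  rw [hr, one_smul]

end CoxeterSystem

/-- The permutation of `C × G` induced by an involution `next` of `C` and an invariant function
`emit : C → G`: it moves the state and multiplies the second component by the emitted element. -/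
def emittingPerm {C G : Type*} [Group G] (next : C → C) (emit : C → G)
    (hnext : ∀ c, next (next c) = c) (hemit : ∀ c, emit (next c) = emit c) :
    Equiv.Perm (C × G) where
  toFun p := (next p.1, emit p.1 * p.2)
  invFun p := (next p.1, (emit p.1)⁻¹ * p.2)
  left_inv p := by simp [hnext, hemit]
  right_inv p := by simp [hnext, hemit]

namespace CoxeterSystem

open Real CoxeterMatrix

variable {B W : Type*} [Group W] {M : CoxeterMatrix B} (cs : CoxeterSystem M W) (X : Set B)

/-- The elements that are of minimal length in their left coset of the parabolic subgroup
generated by `X`, described as those that keep all simple roots in `X` positive. -/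
@[ext] structure MinReps where
  /-- The underlying element. -/
  val : W
  root_nonneg : ∀ x ∈ X, 0 ≤ cs.root val x

variable {cs X}

namespace MinReps

/-- The reflection `s` stabilizes the coset of `c`, and corresponds there to `x ∈ X`. -/
def Loops (c : MinReps cs X) (s : B) (x : X) : Prop := cs.root c.1 x = simpleRoot s

lemma Loops.unique {c : MinReps cs X} {s : B} {x y : X} (hx : Loops c s x) (hy : Loops c s y) :
    x = y :=
  Subtype.ext <| simpleRoot_injective <| (cs.geomRep c.1).injective <| hx.trans hy.symm

lemma not_loops_iff {c : MinReps cs X} {s : B} :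
    (¬∃ x, Loops c s x) ↔ ∀ x ∈ X, cs.root c.1 x ≠ simpleRoot s := by
  simp [Loops]

open scoped Classical in
/-- The action of a simple reflection on the minimal coset representatives. -/
noncomputable def next (s : B) (c : MinReps cs X) : MinReps cs X :=
  if h : ∃ x, Loops c s x then c
  else ⟨cs.simple s * c.1, fun x hx =>
    cs.root_simple_mul_nonneg (c.root_nonneg x hx) (not_loops_iff.1 h x hx)⟩

lemma next_of_loops {c : MinReps cs X} {s : B} {x : X} (h : Loops c s x) : next s c = c :=
  dif_pos ⟨x, h⟩

lemma next_val {c : MinReps cs X} {s : B} (h : ¬∃ x, Loops c s x) :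
    (next s c).1 = cs.simple s * c.1 := by
  rw [next, dif_neg h]

lemma exists_loops_of_next_eq {c : MinReps cs X} {s : B} (h : next s c = c) :
    ∃ x, Loops c s x := by
  by_contra hcon
  have h' := next_val hcon
  rw [h, right_eq_mul] at h'
  have := cs.length_simple s
  simp [h'] at this

lemma not_loops_next {c : MinReps cs X} {s : B} (h : ¬∃ x, Loops c s x) :
    ¬∃ x, Loops (next s c) s x := by
  rintro ⟨x, hx⟩
  rw [Loops, next_val h, root_simple_mul, ← cs.geomRep_simple s, cs.geomRep_eq_iff,
    inv_simple, geomRep_simple, simpleReflection_simpleRoot_self] at hx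
  have := c.root_nonneg x x.2 s
  rw [hx] at this
  simp [simpleRoot] at this
  linarith

@[simp] lemma next_next (s : B) (c : MinReps cs X) : next s (next s c) = c := by
  by_cases h : ∃ x, Loops c s x
  · obtain ⟨x, hx⟩ := h
    simp [next_of_loops hx]
  · apply MinReps.ext
    rw [next_val (not_loops_next h), next_val h, simple_mul_simple_cancel_left]

variable {G : Type*} [Group G] (e : X → G)

open scoped Classical in
/-- The generator of the parabolic subgroup produced when a simple reflection acts on a minimal
coset representative. -/
noncomputable def emit (s : B) (c : MinReps cs X) : G :=
  if h : ∃ x, Loops c s x then e h.choose else 1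

lemma emit_of_loops {c : MinReps cs X} {s : B} {x : X} (h : Loops c s x) : emit e s c = e x := by
  have h' : ∃ x, Loops c s x := ⟨x, h⟩
  rw [emit, dif_pos h', h'.choose_spec.unique h]

lemma emit_of_not_loops {c : MinReps cs X} {s : B} (h : ¬∃ x, Loops c s x) : emit e s c = 1 :=
  dif_neg h

lemma emit_next (s : B) (c : MinReps cs X) : emit e s (next s c) = emit e s c := by
  by_cases h : ∃ x, Loops c s x
  · obtain ⟨x, hx⟩ := h
    rw [next_of_loops hx]
  · rw [emit_of_not_loops e h, emit_of_not_loops e (not_loops_next h)]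

variable (cs) in
/-- The action of a generator of the Artin group on `MinReps cs X × G`. -/
noncomputable def actPerm (s : B) : Equiv.Perm (MinReps cs X × G) :=
  emittingPerm (next s) (emit e s) (next_next s) (emit_next e s)

lemma actPerm_apply (s : B) (c : MinReps cs X) (a : G) :
    actPerm cs e s (c, a) = (next s c, emit e s c * a) := rfl

lemma actPerm_of_loops {c : MinReps cs X} {s : B} {x : X} (h : Loops c s x) (a : G) :
    actPerm cs e s (c, a) = (c, e x * a) := by
  rw [actPerm_apply, next_of_loops h, emit_of_loops e h]

lemma actPerm_of_not_loops {c : MinReps cs X} {s : B} (h : ¬∃ x, Loops c s x) (a : G) :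
    actPerm cs e s (c, a) = (next s c, a) := by
  rw [actPerm_apply, emit_of_not_loops e h, one_mul]

variable (cs) in
/-- The action of a segment of an alternating word on `MinReps cs X × G`. -/
noncomputable def actProd (s t : B) (i k : ℕ) : Equiv.Perm (MinReps cs X × G) :=
  descProd (fun j => actPerm cs e (alternate s t j)) i k

@[simp] lemma actProd_zero (s t : B) (i : ℕ) : actProd cs e s t i 0 = 1 := rfl

lemma actProd_succ_apply (s t : B) (i k : ℕ) (p : MinReps cs X × G) :
    actProd cs e s t i (k + 1) p =
      actProd cs e s t (i + 1) k (actPerm cs e (alternate s t i) p) := rfl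

lemma actProd_add_apply (s t : B) (i k l : ℕ) (p : MinReps cs X × G) :
    actProd cs e s t i (k + l) p = actProd cs e s t (i + k) l (actProd cs e s t i k p) := by
  rw [actProd, descProd_add]
  rfl

lemma actProd_eq_of_mod (s t : B) {i j : ℕ} (h : i % 2 = j % 2) (k : ℕ) :
    actProd cs e s t i k = actProd cs e s t j k :=
  descProd_alternate_eq_of_mod _ s t h k

lemma actProd_swap (s t : B) (i k : ℕ) :
    actProd cs e t s i k = actProd cs e s t (i + 1) k :=
  descProd_alternate_swap _ s t i k

/-- The braid relation between `s` and `t` holds at the state `c`. -/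
def BraidAt (e : X → G) (s t : B) (c : MinReps cs X) : Prop :=
  ∀ a : G, actProd cs e s t 0 (M s t) (c, a) = actProd cs e s t 1 (M s t) (c, a)

variable {e}

lemma BraidAt.symm {s t : B} {c : MinReps cs X} (h : BraidAt e s t c) : BraidAt e t s c := by
  intro a
  rw [actProd_swap e s t 0, actProd_swap e s t 1, M.symmetric t s,
    actProd_eq_of_mod e s t (i := 1 + 1) (j := 0) rfl]
  exact (h a).symm

lemma eq_of_cos_pi_div_eq {m n : ℕ} (h : cos (π / m) = cos (π / n)) : m = n := by
  have hmem (k : ℕ) : π / k ∈ Set.Icc 0 π := by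
    refine ⟨by positivity, ?_⟩
    rcases Nat.eq_zero_or_pos k with rfl | hk
    · simp [pi_pos.le]
    · exact div_le_self pi_pos.le (by exact_mod_cast hk)
  have := injOn_cos (hmem m) (hmem n) h
  rw [div_eq_mul_inv, div_eq_mul_inv, mul_right_inj' pi_ne_zero, inv_inj] at this
  exact_mod_cast this

lemma Loops.matrix_eq {c : MinReps cs X} {s t : B} {x y : X} (hx : Loops c s x)
    (hy : Loops c t y) : M x y = M s t := by
  have h := cs.titsForm_root c.1 x y
  rw [hx, hy, titsForm_simpleRoot, simpleCoroot_simpleRoot] at h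
  exact eq_of_cos_pi_div_eq (by linarith)

lemma braidAt_of_loops_of_loops {s t : B} {c : MinReps cs X} {x y : X} (hx : Loops c s x)
    (hy : Loops c t y)
    (he : descProd (fun j => e (alternate x y j)) 0 (M x y) =
      descProd (fun j => e (alternate x y j)) 1 (M x y)) : BraidAt e s t c := by
  have key (i k : ℕ) (a : G) : actProd cs e s t i k (c, a) =
      (c, descProd (fun j => e (alternate x y j)) i k * a) := by
    induction k generalizing i a with
    | zero => simp
    | succ k ih =>
      have hl : Loops c (alternate s t i) (alternate x y i) := by
        unfold alternate
        split_ifs <;> assumption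
      rw [actProd_succ_apply, actPerm_of_loops e hl, ih, descProd_succ, mul_assoc]
  intro a
  rw [key, key, ← hx.matrix_eq hy, he]

/-- The states visited when reading an alternating word. -/
noncomputable def walk (s t : B) (c : MinReps cs X) : ℕ → MinReps cs X
  | 0 => c
  | j + 1 => next (alternate s t j) (walk s t c j)

lemma next_walk_succ (s t : B) (c : MinReps cs X) (j : ℕ) :
    next (alternate s t j) (walk s t c (j + 1)) = walk s t c j :=
  next_next _ _

section Walk

variable {s t : B} {c : MinReps cs X} {n : ℕ}

lemma walk_val (h : ∀ j < n, ¬∃ x, Loops (walk s t c j) (alternate s t j) x) :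
    ∀ j ≤ n, (walk s t c j).1 = cs.altProd s t 0 j * c.1 := by
  intro j hj
  induction j with
  | zero => simp [walk, altProd]
  | succ j ih =>
    rw [walk, next_val (h j (by omega)), ih (by omega), altProd, altProd, descProd_succ',
      Nat.zero_add, mul_assoc]

lemma actProd_walk (h : ∀ j < n, ¬∃ x, Loops (walk s t c j) (alternate s t j) x) (a : G) {i k : ℕ}
    (hk : i + k ≤ n) : actProd cs e s t i k (walk s t c i, a) = (walk s t c (i + k), a) := by
  induction k generalizing i with
  | zero => simp
  | succ k ih =>
    rw [actProd_succ_apply, actPerm_of_not_loops e (h i (by omega))]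
    have := ih (i := i + 1) (by omega)
    rw [walk] at this
    rw [this]
    congr 2
    omega

lemma actProd_walk_back (h : ∀ j < n, ¬∃ x, Loops (walk s t c j) (alternate s t j) x) (a : G)
    {i k : ℕ} (hi : i + k ≤ n) :
    actProd cs e s t (i + k + 1) k (walk s t c (i + k), a) = (walk s t c i, a) := by
  induction k generalizing i with
  | zero => simp
  | succ k ih =>
    have hl := not_loops_next (h (i + k) (by omega))
    rw [alternate_eq_of_mod s t (by omega : (i + k) % 2 = (i + (k + 1) + 1) % 2)] at hl
    have hw : walk s t c (i + (k + 1)) =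
        next (alternate s t (i + (k + 1) + 1)) (walk s t c (i + k)) := by
      rw [alternate_eq_of_mod s t (by omega : (i + (k + 1) + 1) % 2 = (i + k) % 2)]
      rfl
    rw [actProd_succ_apply, hw, actPerm_of_not_loops e hl, next_next,
      actProd_eq_of_mod e s t (by omega : (i + (k + 1) + 1 + 1) % 2 = (i + k + 1) % 2)]
    exact ih (by omega)

/-- If an orbit is a path with loops corresponding to the same generator at both ends, then the
braid relation holds at all its points. -/
lemma braidAt_walk {m : ℕ} (hm : M s t = m + 1)
    (h : ∀ j < m, ¬∃ x, Loops (walk s t c j) (alternate s t j) x) {x : X}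
    (h0 : Loops c t x) (h1 : Loops (walk s t c m) (alternate s t m) x) {i : ℕ} (hi : i ≤ m) :
    BraidAt e s t (walk s t c i) := by
  obtain ⟨k, rfl⟩ := Nat.exists_eq_add_of_le hi
  have hright (a : G) : actProd cs e s t i (M s t) (walk s t c i, a) = (walk s t c k, e x * a) := by
    rw [hm, show i + k + 1 = k + (1 + i) by omega, actProd_add_apply, actProd_walk h a le_rfl,
      actProd_add_apply, actProd_succ_apply, actPerm_of_loops e h1, actProd_zero,
      Equiv.Perm.one_apply, Nat.add_comm i k]
    exact actProd_walk_back h _ (by omega)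
  have hleft (a : G) :
      actProd cs e s t (i + 1) (M s t) (walk s t c i, a) = (walk s t c k, e x * a) := by
    have hback := actProd_walk_back (e := e) h a (i := 0) (k := i) (by omega)
    rw [Nat.zero_add] at hback
    rw [hm, show i + k + 1 = i + (1 + k) by omega, actProd_add_apply, hback,
      actProd_add_apply, actProd_succ_apply,
      alternate_eq_of_mod s t (by omega : (i + 1 + i) % 2 = 1 % 2), alternate_one, walk,
      actPerm_of_loops e h0, actProd_zero, Equiv.Perm.one_apply,
      actProd_eq_of_mod e s t (by omega : (i + 1 + i + 1) % 2 = 0 % 2)]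
    have := actProd_walk (e := e) h (e x * a) (i := 0) (k := k) (by omega)
    rwa [Nat.zero_add] at this
  intro a
  rcases Nat.mod_two_eq_zero_or_one i with hp | hp
  · rw [actProd_eq_of_mod e s t (by omega : 0 % 2 = i % 2),
      actProd_eq_of_mod e s t (by omega : 1 % 2 = (i + 1) % 2), hright, hleft]
  · rw [actProd_eq_of_mod e s t (by omega : 1 % 2 = i % 2),
      actProd_eq_of_mod e s t (by omega : 0 % 2 = (i + 1) % 2), hright, hleft]

/-- Starting from a state where only `t` loops, the alternating walk does not loop before
reaching the far end of the dihedral orbit. -/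
lemma not_loops_walk {m : ℕ} (hst : s ≠ t) (hm : M s t = m + 1) {x : X} (hx : Loops c t x)
    (hs : ¬∃ y, Loops c s y) :
    ∀ j < m, ¬∃ y, Loops (walk s t c j) (alternate s t j) y := by
  intro j
  induction j using Nat.strong_induction_on with
  | _ j ih =>
    rintro hj ⟨y, hy⟩
    have hval := walk_val (n := j) (fun i hi => ih i hi (hi.trans hj)) j le_rfl
    rw [Loops, hval, root_mul, geomRep_eq_iff] at hy
    have hroot := cs.root_altProd_inv hst 0 j
    rw [root, Nat.zero_add, ← hy, alternate_zero, Nat.zero_add, alternate_one] at hroot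
    rcases Nat.eq_zero_or_pos j with rfl | hj0
    · rw [Nat.zero_add, dihedralCoeff_one (M.off_diagonal s t hst)] at hroot
      exact hs ⟨y, by rw [Loops]; simpa using hroot⟩
    have hp := dihedralCoeff_pos (m := M s t) (k := j + 1) (by omega) (by omega) (by omega)
    have hq := dihedralCoeff_pos (m := M s t) (k := j) (by omega) (by omega) (by omega)
    generalize dihedralCoeff (M s t) (j + 1) = p at hroot hp
    generalize dihedralCoeff (M s t) j = q at hroot hq
    have hxy : y ≠ x := by
      rintro rfl
      rw [hx] at hroot
      have := DFunLike.congr_fun hroot s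
      simp [simpleRoot, hst.symm] at this
      linarith
    have hxy' : (x : B) ≠ y := fun h => hxy (Subtype.ext h.symm)
    have hinv : simpleRoot (y : B) = p • cs.root c.1⁻¹ s + q • simpleRoot (x : B) := by
      have h1 := (cs.geomRep_eq_iff _ _ _).1 hroot
      have h2 := (cs.geomRep_eq_iff _ _ _).1 hx
      rw [h1, h2]
      simp [root]
    have hcy := DFunLike.congr_fun hinv (y : B)
    have hcx := DFunLike.congr_fun hinv (x : B)
    simp [simpleRoot, hxy', hxy'.symm] at hcy hcx
    rcases cs.root_nonneg_or_nonpos c.1⁻¹ s with h | h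
    · have := h x
      simp only [Finsupp.coe_zero, Pi.zero_apply] at this
      nlinarith [mul_nonneg hp.le this]
    · have := h y
      simp only [Finsupp.coe_zero, Pi.zero_apply] at this
      nlinarith [mul_nonneg hp.le (neg_nonneg.2 this)]

/-- The loop at the far end of a dihedral orbit corresponds to the same generator. -/
lemma loops_walk {m : ℕ} (hst : s ≠ t) (hm : M s t = m + 1) {x : X} (hx : Loops c t x)
    (hs : ¬∃ y, Loops c s y) : Loops (walk s t c m) (alternate s t m) x := by
  have hval := walk_val (not_loops_walk hst hm hx hs) m le_rfl
  have hroot := cs.root_altProd_inv hst 0 m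
  rw [Loops, hval, root_mul, geomRep_eq_iff, hx]
  rw [root, Nat.zero_add] at hroot
  have h1 : M s t - 1 = m := by omega
  rw [hroot, ← hm, dihedralCoeff_self (by omega), ← h1,
    dihedralCoeff_pred (by omega) (M.off_diagonal s t hst)]
  simp

end Walk

lemma walk_reverse (s t : B) (c : MinReps cs X) {n i : ℕ} (hi : i ≤ n) :
    walk (alternate s t (n + 1)) (alternate s t n) (walk s t c n) i = walk s t c (n - i) := by
  induction i with
  | zero => rfl
  | succ i ih =>
    have hl : alternate (alternate s t (n + 1)) (alternate s t n) i =
        alternate s t (n - (i + 1)) := by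
      unfold alternate
      split_ifs <;> first | rfl | omega
    rw [walk, ih (by omega), hl]
    have := next_walk_succ s t c (n - (i + 1))
    rwa [show n - (i + 1) + 1 = n - i by omega] at this

/-- The braid relation holds at every state from which an alternating walk reaches a loop. -/
lemma braidAt_of_exists_loops {s t : B} (hst : s ≠ t)
    (he : ∀ x y : X, x ≠ y → M x y ≠ 0 → descProd (fun j => e (alternate x y j)) 0 (M x y) =
      descProd (fun j => e (alternate x y j)) 1 (M x y)) {c : MinReps cs X}
    (h : ∃ j < M s t, ∃ x, Loops (walk s t c j) (alternate s t j) x) : BraidAt e s t c := by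
  classical
  obtain ⟨hlt, x, hx⟩ := Nat.find_spec h
  have hmin : ∀ j < Nat.find h, ¬∃ x, Loops (walk s t c j) (alternate s t j) x :=
    fun j hj hcon => Nat.find_min h hj ⟨hj.trans hlt, hcon⟩
  generalize Nat.find h = n at hlt hx hmin
  by_cases hother : ∃ y, Loops (walk s t c n) (alternate s t (n + 1)) y
  · obtain rfl : n = 0 := by
      by_contra hn
      obtain ⟨n, rfl⟩ := Nat.exists_eq_succ_of_ne_zero hn
      rw [alternate_eq_of_mod s t (by omega : (n + 1 + 1) % 2 = n % 2)] at hother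
      exact not_loops_next (hmin n (by omega)) hother
    obtain ⟨y, hy⟩ := hother
    have hxy : x ≠ y := by
      rintro rfl
      exact hst (simpleRoot_injective (hx.symm.trans hy))
    exact braidAt_of_loops_of_loops hx hy (he x y hxy (by rw [hx.matrix_eq hy]; simp; omega))
  · obtain ⟨m, hm⟩ := Nat.exists_eq_succ_of_ne_zero (by omega : M s t ≠ 0)
    have hM : M (alternate s t (n + 1)) (alternate s t n) = m + 1 := by
      rw [M.symmetric, matrix_alternate, hm]
    have hne : alternate s t (n + 1) ≠ alternate s t n := by
      unfold alternate
      split_ifs <;> first | exact hst | exact hst.symm | omega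
    have hb := braidAt_walk (e := e) hM (not_loops_walk hne hM hx hother) hx
      (loops_walk hne hM hx hother) (i := n) (by omega)
    rw [walk_reverse s t c le_rfl, Nat.sub_self, walk] at hb
    rcases Nat.mod_two_eq_zero_or_one n with hp | hp
    · rw [alternate_eq_of_mod s t (by omega : (n + 1) % 2 = 1 % 2),
        alternate_eq_of_mod s t (by omega : n % 2 = 0 % 2)] at hb
      exact hb.symm
    · rwa [alternate_eq_of_mod s t (by omega : (n + 1) % 2 = 0 % 2),
        alternate_eq_of_mod s t (by omega : n % 2 = 1 % 2)] at hb

/-- The permutations `actPerm` satisfy the braid relations. -/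
theorem braidAt {s t : B} (hst : s ≠ t)
    (he : ∀ x y : X, x ≠ y → M x y ≠ 0 → descProd (fun j => e (alternate x y j)) 0 (M x y) =
      descProd (fun j => e (alternate x y j)) 1 (M x y)) (c : MinReps cs X) : BraidAt e s t c := by
  by_cases h1 : ∃ j < M s t, ∃ x, Loops (walk s t c j) (alternate s t j) x
  · exact braidAt_of_exists_loops hst he h1
  by_cases h2 : ∃ j < M t s, ∃ x, Loops (walk t s c j) (alternate t s j) x
  · exact (braidAt_of_exists_loops hst.symm he h2).symm
  replace h1 : ∀ j < M s t, ¬∃ x, Loops (walk s t c j) (alternate s t j) x :=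
    fun j hj hx => h1 ⟨j, hj, hx⟩
  replace h2 : ∀ j < M s t, ¬∃ x, Loops (walk t s c j) (alternate t s j) x :=
    fun j hj hx => h2 ⟨j, by rwa [M.symmetric], hx⟩
  intro a
  have e1 := actProd_walk (e := e) h1 a (i := 0) (k := M s t) (by omega)
  have e2 := actProd_walk (e := e) h2 a (i := 0) (k := M s t) (by omega)
  rw [actProd_swap] at e2
  have hend : walk s t c (0 + M s t) = walk t s c (0 + M s t) := by
    apply MinReps.ext
    rw [Nat.zero_add, walk_val h1 _ le_rfl, walk_val h2 _ le_rfl, altProd_braid]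
    exact congrArg (· * c.1) (descProd_alternate_swap cs.simple s t 0 (M s t)).symm
  rw [hend] at e1
  exact e1.trans e2.symm

end MinReps

end CoxeterSystem

namespace ArtinGroup

open CoxeterSystem hiding braidWord
open CoxeterMatrix MinReps

variable {S : Type*} {M : S → S → ℕ∞}

lemma lift_braidWord {G : Type*} [Group G] (f : S → G) (s t : S) (k : ℕ) :
    FreeGroup.lift f (braidWord k s t) =
      ((List.range k).map fun j => f (alternate s t j)).prod := by
  rw [braidWord, map_list_prod, List.map_map]
  congr 2
  funext j
  exact FreeGroup.lift_apply_of

lemma lift_artinRels_eq_one {G : Type*} [Group G] {f : S → G}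
    (hf : ∀ s t, s ≠ t → ∀ k : ℕ, M s t = k →
      descProd (fun j => f (alternate s t j)) 0 k = descProd (fun j => f (alternate s t j)) 1 k) :
    ∀ r ∈ artinRels M, FreeGroup.lift f r = 1 := by
  rintro _ ⟨s, t, hst, k, hk, rfl⟩
  rw [map_mul, map_inv, mul_inv_eq_one, lift_braidWord, lift_braidWord,
    prod_map_range_alternate_eq_iff]
  exact hf s t hst k hk

lemma descProd_of {s t : S} (hst : s ≠ t) {k : ℕ} (hk : M s t = k) :
    descProd (fun j => (PresentedGroup.of (alternate s t j) : ArtinGroup M)) 0 k =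
      descProd (fun j => (PresentedGroup.of (alternate s t j) : ArtinGroup M)) 1 k := by
  have h := PresentedGroup.one_of_mem (rels := artinRels M) ⟨s, t, hst, k, hk, rfl⟩
  have hlift : (PresentedGroup.mk (artinRels M)) = FreeGroup.lift PresentedGroup.of := by
    ext
    simp [PresentedGroup.of]
  rw [hlift, map_mul, map_inv, mul_inv_eq_one, lift_braidWord, lift_braidWord] at h
  exact (prod_map_range_alternate_eq_iff _ s t k).1 h

variable (M) in
/-- A generator of a standard parabolic subgroup. -/
def parabolicGen (X : Set S) (x : X) : StandardParabolic M X :=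
  ⟨PresentedGroup.of x, Subgroup.subset_closure ⟨x, x.2, rfl⟩⟩

lemma descProd_parabolicGen {X : Set S} {x y : X} (hxy : x ≠ y) {k : ℕ} (hk : M x y = k) :
    descProd (fun j => parabolicGen M X (alternate x y j)) 0 k =
      descProd (fun j => parabolicGen M X (alternate x y j)) 1 k := by
  apply Subtype.val_injective
  have h := descProd_of (M := M) (fun h => hxy (Subtype.ext h)) hk
  simp only [← comp_alternate (Subtype.val : X → S)] at h
  change (StandardParabolic M X).subtype _ = (StandardParabolic M X).subtype _
  rw [map_descProd, map_descProd]
  exact h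

variable {C : CoxeterMatrix S} {W : Type*} [Group W] (cs : CoxeterSystem C W) (X : Set S)

lemma descProd_actPerm (hC : ∀ s t, s ≠ t → C s t = (M s t).toNat) {s t : S} (hst : s ≠ t) {k : ℕ}
    (hk : M s t = k) :
    descProd (fun j => actPerm cs (parabolicGen M X) (alternate s t j)) 0 k =
      descProd (fun j => actPerm cs (parabolicGen M X) (alternate s t j)) 1 k := by
  obtain rfl : C s t = k := by rw [hC s t hst, hk, ENat.toNat_natCast]
  ext1 ⟨c, a⟩
  refine braidAt hst (fun x y hxy h => descProd_parabolicGen hxy ?_) c a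
  have hxy' : (x : S) ≠ y := fun h => hxy (Subtype.ext h)
  rw [hC x y hxy'] at h ⊢
  exact (ENat.natCast_toNat fun htop => h (by rw [htop, ENat.toNat_top])).symm

/-- The action of an Artin group on the product of the minimal coset representatives of a
parabolic subgroup of the Coxeter group with the corresponding parabolic subgroup. -/
noncomputable def cosetAction (hC : ∀ s t, s ≠ t → C s t = (M s t).toNat) :
    ArtinGroup M →* Equiv.Perm (MinReps cs X × StandardParabolic M X) :=
  PresentedGroup.toGroup (f := actPerm cs (parabolicGen M X))
    (lift_artinRels_eq_one fun _ _ hst _ hk => descProd_actPerm cs X hC hst hk)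

variable (hC : ∀ s t, s ≠ t → C s t = (M s t).toNat)

lemma cosetAction_of (s : S) :
    cosetAction cs X hC (PresentedGroup.of s) = actPerm cs (parabolicGen M X) s :=
  PresentedGroup.toGroup.of _

lemma cosetAction_mul_right (h : ArtinGroup M) (c : MinReps cs X) (a b : StandardParabolic M X) :
    cosetAction cs X hC h (c, a * b) =
      ((cosetAction cs X hC h (c, a)).1, (cosetAction cs X hC h (c, a)).2 * b) := by
  have hcomm : Commute (cosetAction cs X hC h) ((Equiv.refl _).prodCongr (Equiv.mulRight b)) := by
    have hmem : h ∈ Subgroup.closure (Set.range (PresentedGroup.of (rels := artinRels M))) := by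
      simp
    induction hmem using Subgroup.closure_induction with
    | mem _ hs =>
      obtain ⟨s, rfl⟩ := hs
      ext1 ⟨c, a⟩
      simp [cosetAction_of, actPerm_apply, mul_assoc]
    | one => simp
    | mul _ _ _ _ hx hy => rw [map_mul]; exact hx.mul_left hy
    | inv _ _ hx => rw [map_inv]; exact hx.inv_left
  exact DFunLike.congr_fun hcomm.eq (c, a)

/-- The minimal representative of the trivial coset. -/
def baseRep : MinReps cs X where
  val := 1
  root_nonneg x _ := by
    rw [root_one]
    exact Finsupp.single_nonneg.2 zero_le_one

lemma loops_baseRep (x : X) : (baseRep cs X).Loops x x := by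
  rw [Loops, baseRep, root_one]

lemma cosetAction_baseRep (b a : StandardParabolic M X) :
    cosetAction cs X hC b (baseRep cs X, a) = (baseRep cs X, b * a) := by
  obtain ⟨b, hb⟩ := b
  induction hb using Subgroup.closure_induction generalizing a with
  | mem _ hx =>
    obtain ⟨x, hx, rfl⟩ := hx
    rw [cosetAction_of]
    exact actPerm_of_loops _ (loops_baseRep cs X ⟨x, hx⟩) a
  | one =>
    rw [map_one]
    exact congrArg (Prod.mk _) (one_mul a).symm
  | mul x y hx hy ihx ihy =>
    rw [map_mul, Equiv.Perm.mul_apply, ihy, ihx, ← mul_assoc]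
    rfl
  | inv x hx ih =>
    rw [map_inv, Equiv.Perm.inv_eq_iff_eq, ih]
    exact congrArg (Prod.mk _) (mul_inv_cancel_left ⟨x, hx⟩ a).symm

/-- If a conjugate of a generator by `g` lies in `A_X`, then it is conjugate inside `A_X`, by an
element depending only on `g`, to a generator of `A_X`. -/
lemma exists_conj_of_eq (cs : CoxeterSystem C W) (X : Set S)
    (hC : ∀ s t, s ≠ t → C s t = (M s t).toNat) (g : ArtinGroup M) :
    ∃ p ∈ StandardParabolic M X, ∀ s : S,
      g * PresentedGroup.of s * g⁻¹ ∈ StandardParabolic M X →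
        ∃ x ∈ X, g * PresentedGroup.of s * g⁻¹ = p⁻¹ * PresentedGroup.of x * p := by
  rcases h : cosetAction cs X hC g⁻¹ (baseRep cs X, 1) with ⟨w, p⟩
  refine ⟨p, p.2, fun s hs => ?_⟩
  set b : StandardParabolic M X := ⟨_, hs⟩ with hb
  have h1 : cosetAction cs X hC (PresentedGroup.of s) (w, p) = (w, p * b) := by
    rw [← h, ← Equiv.Perm.mul_apply, ← map_mul,
      show PresentedGroup.of s * g⁻¹ = g⁻¹ * (b : ArtinGroup M) by simp [hb, mul_assoc], map_mul,
      Equiv.Perm.mul_apply, cosetAction_baseRep, mul_one]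
    have := cosetAction_mul_right cs X hC g⁻¹ (baseRep cs X) 1 b
    rwa [one_mul, h] at this
  rw [cosetAction_of, actPerm_apply] at h1
  obtain ⟨x, hx⟩ := exists_loops_of_next_eq (congrArg Prod.fst h1)
  have h2 := congrArg Prod.snd h1
  rw [emit_of_loops _ hx] at h2
  refine ⟨x, x.2, ?_⟩
  rw [mul_assoc (_)⁻¹, eq_inv_mul_iff_mul_eq]
  exact (congrArg Subtype.val h2).symm

end ArtinGroup

lemma conjSubgroup_conjSubgroup {G : Type*} [Group G] (g h : G) (H : Subgroup G) :
    conjSubgroup g (conjSubgroup h H) = conjSubgroup (g * h) H := by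
  rw [conjSubgroup, conjSubgroup, conjSubgroup, Subgroup.map_map, map_mul]
  rfl

lemma conjSubgroup_eq_self {G : Type*} [Group G] {g : G} {H : Subgroup G} (hg : g ∈ H) :
    conjSubgroup g H = H :=
  Subgroup.conj_smul_eq_self_of_mem hg

lemma conjSubgroup_closure_image {S G : Type*} [Group G] (f : S → G) (g : G) (X : Set S) :
    conjSubgroup g (Subgroup.closure (f '' X)) =
      Subgroup.closure ((fun s => g * f s * g⁻¹) '' X) := by
  rw [conjSubgroup, MonoidHom.map_closure, ← Set.image_comp]
  rfl

namespace ArtinGroup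

open scoped Classical in
/-- The Coxeter matrix of an Artin group. -/
noncomputable def coxeterMatrix {S : Type*} (M : S → S → ℕ∞) (hsymm : ∀ s t, M s t = M t s)
    (hM : ∀ s t, s ≠ t → M s t ≠ 1) : CoxeterMatrix S where
  M := Matrix.of fun s t => if s = t then 1 else (M s t).toNat
  isSymm := by
    ext s t
    simp [hsymm s t, eq_comm]
  diagonal := by simp
  off_diagonal s t h := by simpa [h, ENat.toNat_eq_iff] using hM s t h

lemma coxeterMatrix_apply {S : Type*} {M : S → S → ℕ∞} (hsymm : ∀ s t, M s t = M t s)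
    (hM : ∀ s t, s ≠ t → M s t ≠ 1) {s t : S} (hst : s ≠ t) :
    coxeterMatrix M hsymm hM s t = (M s t).toNat := by
  simp [coxeterMatrix, hst]

/-- If a conjugate of a standard parabolic subgroup lies in `A_X`, then it is conjugate inside
`A_X` to a standard parabolic subgroup. -/
theorem exists_conjSubgroup_eq {S : Type*} {M : S → S → ℕ∞} (hsymm : ∀ s t, M s t = M t s)
    (hM : ∀ s t, s ≠ t → M s t ≠ 1) (g : ArtinGroup M) (X Y : Set S)
    (h : conjSubgroup g (StandardParabolic M Y) ≤ StandardParabolic M X) :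
    ∃ p ∈ StandardParabolic M X, ∃ Z ⊆ X,
      conjSubgroup g (StandardParabolic M Y) = conjSubgroup p (StandardParabolic M Z) := by
  obtain ⟨p, hp, hex⟩ := exists_conj_of_eq (coxeterMatrix M hsymm hM).toCoxeterSystem X
    (fun _ _ => coxeterMatrix_apply hsymm hM) g
  have hmem (s : Y) : g * PresentedGroup.of (s : S) * g⁻¹ ∈ StandardParabolic M X :=
    h ⟨_, Subgroup.subset_closure ⟨s, s.2, rfl⟩, rfl⟩
  choose f hfX hf using fun s : Y => hex s (hmem s)
  refine ⟨p⁻¹, inv_mem hp, Set.range f, Set.range_subset_iff.2 hfX, ?_⟩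
  rw [StandardParabolic, StandardParabolic, conjSubgroup_closure_image, conjSubgroup_closure_image]
  congr 1
  rw [Set.image_eq_range, ← Set.range_comp]
  congr 1
  funext s
  simpa using hf s

end ArtinGroup

/-- In a large-type Artin group, an inclusion of parabolic subgroups is conjugate to an
inclusion of standard parabolic subgroups. -/
theorem inclusion_of_parabolics_conjugate_to_standard {S : Type*} [Finite S]
    (M : S → S → ℕ∞)
    (hsymm : ∀ s t : S, M s t = M t s)
    (hlarge : ∀ s t : S, s ≠ t → 3 ≤ M s t)
    (P₁ P₂ : Subgroup (ArtinGroup M))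
    (h₁ : IsParabolic M P₁) (h₂ : IsParabolic M P₂) (hle : P₁ ≤ P₂) :
    ∃ (g : ArtinGroup M) (S'' S' : Set S), S'' ⊆ S' ∧
      P₁ = conjSubgroup g (StandardParabolic M S'') ∧
      P₂ = conjSubgroup g (StandardParabolic M S') := by
  obtain ⟨g₁, Y, rfl⟩ := h₁
  obtain ⟨g₂, X, rfl⟩ := h₂
  have hM (s t : S) (hst : s ≠ t) : M s t ≠ 1 := by
    intro h
    have := hlarge s t hst
    rw [h] at this
    exact absurd this (by decide)
  have hconj : conjSubgroup (g₂⁻¹ * g₁) (StandardParabolic M Y) ≤ StandardParabolic M X := by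
    rw [← conjSubgroup_conjSubgroup]
    refine (Subgroup.map_mono hle).trans_eq ?_
    rw [← conjSubgroup, conjSubgroup_conjSubgroup, inv_mul_cancel, conjSubgroup_eq_self (one_mem _)]
  obtain ⟨p, hp, Z, hZ, heq⟩ := ArtinGroup.exists_conjSubgroup_eq hsymm hM _ X Y hconj
  refine ⟨g₂ * p, Z, X, hZ, ?_, ?_⟩
  · rw [← conjSubgroup_conjSubgroup, ← heq, conjSubgroup_conjSubgroup, mul_inv_cancel_left]
  · rw [← conjSubgroup_conjSubgroup, conjSubgroup_eq_self hp]
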